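/- Let t₀ < T, let A, Q : [t₀,T] → ℝ^{n×n}, B : [t₀,T] → ℝ^{n×m}, R : [t₀,T] → ℝ^{m×m} be continuous, and let H ∈ ℝ^{n×n}. Suppose x : [t₀,T] → ℝⁿ is differentiable with x'(t) = A(t)x(t) + B(t)u(t) for a continuous control u, p : [t₀,T] → ℝⁿ is differentiable with p'(t) = -(A(t)ᵀp(t) + Q(t)x(t)) and p(T) = H x(T), and R(t)u(t) + B(t)ᵀp(t) = 0 for all t ∈ [t₀,T]. Then ∫_{t₀}^T (x(t)ᵀQ(t)x(t) + u(t)ᵀR(t)u(t)) dt + x(T)ᵀ H x(T) = x(t₀)ᵀ p(t₀). In particular, if moreover p(t) = (P(t) + P₁(t)) x(t) with P(T) = H and P₁(T) x(T) = 0, then the cost equals x(t₀)ᵀ (P(t₀) + P₁(t₀)) x(t₀). -/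

import Mathlib

open Matrix Set intervalIntegral

/-- Product rule for the dot product of two vector-valued curves. -/
theorem HasDerivWithinAt.dotProduct_fin {ι : Type*} [Fintype ι] {f g : ℝ → ι → ℝ} {f' g' : ι → ℝ}
    {s : Set ℝ} {t : ℝ} (hf : HasDerivWithinAt f f' s t) (hg : HasDerivWithinAt g g' s t) :
    HasDerivWithinAt (fun t => f t ⬝ᵥ g t) (f' ⬝ᵥ g t + f t ⬝ᵥ g') s t := by
  simp only [dotProduct, ← Finset.sum_add_distrib]
  exact HasDerivWithinAt.fun_sum fun i _ =>
    (hasDerivWithinAt_pi.mp hf i).mul (hasDerivWithinAt_pi.mp hg i)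

/-- A quadratic form with continuous coefficients is continuous along a continuous curve. -/
theorem ContinuousOn.dotProduct_mulVec_self {ι : Type*} [Fintype ι] {M : ℝ → Matrix ι ι ℝ}
    {v : ℝ → ι → ℝ} {s : Set ℝ} (hM : ∀ i j, ContinuousOn (fun t => M t i j) s)
    (hv : ContinuousOn v s) : ContinuousOn (fun t => v t ⬝ᵥ (M t *ᵥ v t)) s := by
  have hvi := continuousOn_pi.mp hv
  simp only [dotProduct, mulVec]
  exact continuousOn_finsetSum _ fun i _ => (hvi i).mul <|
    continuousOn_finsetSum _ fun j _ => (hM i j).mul (hvi j)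

/-- Along an extremal, the derivative of `x ⬝ᵥ p` is minus the running cost. -/
theorem dotProduct_costate_deriv {ι κ : Type*} [Fintype ι] [Fintype κ] (A Q : Matrix ι ι ℝ)
    (B : Matrix ι κ ℝ) (R : Matrix κ κ ℝ) (x p : ι → ℝ) (u : κ → ℝ)
    (h : R *ᵥ u + Bᵀ *ᵥ p = 0) :
    (A *ᵥ x + B *ᵥ u) ⬝ᵥ p + x ⬝ᵥ (-(Aᵀ *ᵥ p + Q *ᵥ x)) =
      -(x ⬝ᵥ (Q *ᵥ x) + u ⬝ᵥ (R *ᵥ u)) := by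
  have hA : x ⬝ᵥ (Aᵀ *ᵥ p) = (A *ᵥ x) ⬝ᵥ p := by
    rw [dotProduct_mulVec, vecMul_transpose]
  have hB : u ⬝ᵥ (Bᵀ *ᵥ p) = (B *ᵥ u) ⬝ᵥ p := by
    rw [dotProduct_mulVec, vecMul_transpose]
  have hu : u ⬝ᵥ (R *ᵥ u) + u ⬝ᵥ (Bᵀ *ᵥ p) = 0 := by
    rw [← dotProduct_add, h, dotProduct_zero]
  rw [add_dotProduct, dotProduct_neg, dotProduct_add, hA]
  linarith

/-- Optimal-cost formula: along a trajectory satisfying the maximum-principle conditions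
`x' = Ax + Bu`, `p' = -(Aᵀp + Qx)`, `p(T) = Hx(T)`, `Ru + Bᵀp = 0`, the quadratic cost equals
`x(t₀)ᵀ p(t₀)`; in particular, if `p = (P + P₁)x` with `P(T) = H` and `P₁(T)x(T) = 0`, the
cost equals `x(t₀)ᵀ(P(t₀) + P₁(t₀))x(t₀)`. -/
theorem stmt_11 (n m : ℕ) (t₀ T : ℝ) (ht : t₀ < T)
    (A Q : ℝ → Matrix (Fin n) (Fin n) ℝ)
    (B : ℝ → Matrix (Fin n) (Fin m) ℝ)
    (R : ℝ → Matrix (Fin m) (Fin m) ℝ)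
    (H : Matrix (Fin n) (Fin n) ℝ)
    (hAc : ∀ i j, ContinuousOn (fun t => A t i j) (Icc t₀ T))
    (hQc : ∀ i j, ContinuousOn (fun t => Q t i j) (Icc t₀ T))
    (hBc : ∀ i j, ContinuousOn (fun t => B t i j) (Icc t₀ T))
    (hRc : ∀ i j, ContinuousOn (fun t => R t i j) (Icc t₀ T))
    (x p : ℝ → Fin n → ℝ) (u : ℝ → Fin m → ℝ)
    (huc : ContinuousOn u (Icc t₀ T))
    (hx : ∀ t ∈ Icc t₀ T, HasDerivWithinAt x (A t *ᵥ x t + B t *ᵥ u t) (Icc t₀ T) t)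
    (hp : ∀ t ∈ Icc t₀ T, HasDerivWithinAt p (-((A t)ᵀ *ᵥ p t + Q t *ᵥ x t)) (Icc t₀ T) t)
    (hpT : p T = H *ᵥ x T)
    (heq : ∀ t ∈ Icc t₀ T, R t *ᵥ u t + (B t)ᵀ *ᵥ p t = 0) :
    ((∫ t in t₀..T, (x t ⬝ᵥ (Q t *ᵥ x t) + u t ⬝ᵥ (R t *ᵥ u t))) + x T ⬝ᵥ (H *ᵥ x T)
        = x t₀ ⬝ᵥ p t₀) ∧
    (∀ P P₁ : ℝ → Matrix (Fin n) (Fin n) ℝ,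
      (∀ t ∈ Icc t₀ T, p t = (P t + P₁ t) *ᵥ x t) → P T = H → P₁ T *ᵥ x T = 0 →
      (∫ t in t₀..T, (x t ⬝ᵥ (Q t *ᵥ x t) + u t ⬝ᵥ (R t *ᵥ u t))) + x T ⬝ᵥ (H *ᵥ x T)
        = x t₀ ⬝ᵥ ((P t₀ + P₁ t₀) *ᵥ x t₀)) := by
  have hxc : ContinuousOn x (Icc t₀ T) := fun t h => (hx t h).continuousWithinAt
  have hderiv : ∀ t ∈ Icc t₀ T, HasDerivWithinAt (fun t => x t ⬝ᵥ p t)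
      (-(x t ⬝ᵥ (Q t *ᵥ x t) + u t ⬝ᵥ (R t *ᵥ u t))) (Icc t₀ T) t := fun t h => by
    rw [← dotProduct_costate_deriv _ _ _ _ _ _ _ (heq t h)]
    exact (hx t h).dotProduct_fin (hp t h)
  have hcont : ContinuousOn (fun t => x t ⬝ᵥ (Q t *ᵥ x t) + u t ⬝ᵥ (R t *ᵥ u t)) (Icc t₀ T) :=
    (ContinuousOn.dotProduct_mulVec_self hQc hxc).add
      (ContinuousOn.dotProduct_mulVec_self hRc huc)
  have hint := integral_eq_sub_of_hasDerivAt_of_le ht.le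
    (fun t h => (hderiv t h).continuousWithinAt)
    (fun t h => (hderiv t (Ioo_subset_Icc_self h)).hasDerivAt (Icc_mem_nhds h.1 h.2))
    (hcont.neg.intervalIntegrable_of_Icc ht.le)
  rw [intervalIntegral.integral_neg, hpT] at hint
  have hcost : (∫ t in t₀..T, (x t ⬝ᵥ (Q t *ᵥ x t) + u t ⬝ᵥ (R t *ᵥ u t))) +
      x T ⬝ᵥ (H *ᵥ x T) = x t₀ ⬝ᵥ p t₀ := by linarith
  refine ⟨hcost, fun P P₁ hPp _ _ => ?_⟩
  rw [hcost, hPp t₀ (left_mem_Icc.mpr ht.le)]
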